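/- Let D be a strongly connected digraph on n vertices in which every vertex has out-degree at least 2 and in-degree at least 2. Suppose that for every pair of non-adjacent vertices x, y that have a common in-neighbour, one has d(x) + d(y) ≥ 2n − 1 and min{d(x), d(y)} ≥ n − 1. Then either D contains a cycle of length n − 1, or n is even and D is isomorphic to the complete bipartite digraph K*_{n/2,n/2} or to K*_{n/2,n/2} minus one arc. -/

import Mathlib

/-!
Digraphs are modelled as a finite vertex type `V` together with an arc relation
`A : V → V → Prop` (irreflexive, i.e. no loops; no multiple arcs by construction).
-/

namespace PaperDG

variable {V : Type*}

/-- Out-degree of `v`: the number of out-neighbours. -/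
noncomputable def outDeg (A : V → V → Prop) (v : V) : ℕ := Nat.card {w : V // A v w}

/-- In-degree of `v`: the number of in-neighbours. -/
noncomputable def inDeg (A : V → V → Prop) (v : V) : ℕ := Nat.card {w : V // A w v}

/-- Degree `d(v) = d⁺(v) + d⁻(v)`. -/
noncomputable def deg (A : V → V → Prop) (v : V) : ℕ := outDeg A v + inDeg A v

/-- Strong connectivity: every vertex reaches every other by a directed path. -/
def IsStrong (A : V → V → Prop) : Prop := ∀ x y : V, Relation.ReflTransGen A x y

/-- The digraph has a directed cycle through `k` distinct vertices. -/
def HasCycle (A : V → V → Prop) (k : ℕ) : Prop :=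
  ∃ f : ZMod k → V, Function.Injective f ∧ ∀ i : ZMod k, A (f i) (f (i + 1))

/-- Condition (*): `d(x) + d(y) ≥ 2n - 1` and `min {d(x), d(y)} ≥ n - 1` for every pair of
non-adjacent vertices `x, y` with a common in-neighbour. -/
def CondStar [Fintype V] (A : V → V → Prop) : Prop :=
  ∀ x y : V, x ≠ y → ¬A x y → ¬A y x → (∃ u : V, A u x ∧ A u y) →
    2 * Fintype.card V - 1 ≤ deg A x + deg A y ∧
      Fintype.card V - 1 ≤ min (deg A x) (deg A y)

/-- Condition (**): `min {d⁺(x) + d⁻(y), d⁻(x) + d⁺(y)} ≥ n` for every pair of non-adjacent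
vertices `x, y` with a common in-neighbour or a common out-neighbour. -/
def CondStarStar [Fintype V] (A : V → V → Prop) : Prop :=
  ∀ x y : V, x ≠ y → ¬A x y → ¬A y x →
    ((∃ u : V, A u x ∧ A u y) ∨ (∃ u : V, A x u ∧ A y u)) →
    Fintype.card V ≤ min (outDeg A x + inDeg A y) (inDeg A x + outDeg A y)

/-- The digraph is (isomorphic to) the complete bipartite digraph `K*_{n/2,n/2}`:
there is a part `S` of size `n/2` such that the arcs are exactly the pairs of vertices
lying in different parts. -/
def IsKhalf [Fintype V] (A : V → V → Prop) : Prop :=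
  ∃ S : Set V, 2 * Nat.card S = Fintype.card V ∧
    ∀ x y : V, A x y ↔ (x ∈ S ↔ y ∉ S)

/-- The digraph is (isomorphic to) `K*_{n/2,n/2}` minus one arc. -/
def IsKhalfMinusArc [Fintype V] (A : V → V → Prop) : Prop :=
  ∃ S : Set V, ∃ a b : V, 2 * Nat.card S = Fintype.card V ∧ (a ∈ S ↔ b ∉ S) ∧
    ∀ x y : V, A x y ↔ ((x ∈ S ↔ y ∉ S) ∧ ¬(x = a ∧ y = b))

/-- Minimum semi-degree at least `k`. -/
def MinSemiDegreeGE (A : V → V → Prop) (k : ℕ) : Prop :=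
  ∀ v : V, k ≤ outDeg A v ∧ k ≤ inDeg A v

/-- Locally semicomplete: for every vertex `x` the out-neighbourhood and the
in-neighbourhood of `x` both induce semicomplete digraphs. -/
def LocallySemicomplete (A : V → V → Prop) : Prop :=
  ∀ x u v : V, u ≠ v →
    ((A x u → A x v → A u v ∨ A v u) ∧ (A u x → A v x → A u v ∨ A v u))

end PaperDG

open PaperDG

namespace DK

open Classical in
/-- indicator -/
noncomputable def ind (p : Prop) : ℕ := if p then 1 else 0

theorem ind_le (p : Prop) : ind p ≤ 1 := by unfold ind; split <;> simp
theorem ind_pos {p : Prop} (h : p) : ind p = 1 := by simp [ind, h]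
theorem ind_neg {p : Prop} (h : ¬p) : ind p = 0 := by simp [ind, h]

noncomputable def cnt {V : Type*} (A : V → V → Prop) (w : V) : List V → ℕ
  | [] => 0
  | x :: l => ind (A w x) + ind (A x w) + cnt A w l

/-- path from `a` to `b` with vertex list `l` -/
inductive Pa {V : Type*} (A : V → V → Prop) : V → V → List V → Prop
  | one (a : V) : Pa A a a [a]
  | cons {a b c : V} {l : List V} : A a b → Pa A b c l → Pa A a c (a :: l)

/-- `e → Z → f` -/
def Lk {V : Type*} (A : V → V → Prop) : V → List V → V → Prop
  | e, [], f => A e f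
  | e, z :: Z, f => A e z ∧ Lk A z Z f

def Ins {V : Type*} (A : V → V → Prop) (w : V) (Q : List V) : Prop :=
  ∃ Q1 p q Q2, Q = Q1 ++ p :: q :: Q2 ∧ A p w ∧ A w q

def Cyc {V : Type*} (A : V → V → Prop) (L : List V) : Prop :=
  ∃ f e, Pa A f e L ∧ A e f

def Full {V : Type*} (L : List V) : Prop := L.Nodup ∧ ∀ v : V, v ∈ L

section
variable {V : Type*} {A : V → V → Prop}

theorem cnt_append (w : V) (l l' : List V) : cnt A w (l ++ l') = cnt A w l + cnt A w l' := by
  induction l with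
  | nil => simp [cnt]
  | cons x l ih => simp [cnt, ih]; omega

theorem cnt_perm (w : V) {l l' : List V} (h : l.Perm l') : cnt A w l = cnt A w l' := by
  induction h with
  | nil => rfl
  | cons x _ ih => simp [cnt, ih]
  | swap x y l => simp [cnt]; omega
  | trans _ _ h1 h2 => omega

theorem cnt_le (w : V) (l : List V) : cnt A w l ≤ 2 * l.length := by
  induction l with
  | nil => simp [cnt]
  | cons x l ih =>
    have := ind_le (A w x); have := ind_le (A x w)
    simp [cnt]; omega

theorem cnt_zero {w : V} {l : List V} (h : ∀ x ∈ l, ¬A w x ∧ ¬A x w) : cnt A w l = 0 := by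
  induction l with
  | nil => simp [cnt]
  | cons x l ih =>
    have h1 := h x (by simp)
    simp [cnt, ind_neg h1.1, ind_neg h1.2, ih (fun y hy => h y (by simp [hy]))]

theorem cnt_self (hirr : ∀ v, ¬A v v) {w : V} {l : List V} (h : w ∈ l) :
    cnt A w l + 2 ≤ 2 * l.length := by
  obtain ⟨s, t, rfl⟩ := List.append_of_mem h
  have h1 := cnt_le (A := A) w s
  have h2 := cnt_le (A := A) w t
  simp [cnt_append, cnt, ind_neg (hirr w)]; omega

theorem cnt_pair {w y : V} {l : List V}
    (h : ∀ z ∈ l, ¬(A w z ∧ A z y) ∧ ¬(A y z ∧ A z w)) :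
    cnt A w l + cnt A y l ≤ 2 * l.length := by
  induction l with
  | nil => simp [cnt]
  | cons x l ih =>
    have ih := ih (fun z hz => h z (by simp [hz]))
    obtain ⟨h1, h2⟩ := h x (by simp)
    have a1 : ind (A w x) + ind (A x y) ≤ 1 := by
      unfold ind; split <;> split <;> simp_all
    have a2 : ind (A y x) + ind (A x w) ≤ 1 := by
      unfold ind; split <;> split <;> simp_all
    simp [cnt]; omega

theorem cnt_out {w : V} {l : List V} (h : ∀ x ∈ l, ¬A w x) : cnt A w l ≤ l.length := by
  induction l with
  | nil => simp [cnt]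
  | cons x l ih =>
    have := ind_le (A x w)
    have ih := ih (fun z hz => h z (by simp [hz]))
    simp [cnt, ind_neg (h x (by simp))]; omega

theorem cnt_tail {w : V} {l : List V} (h : ∀ x ∈ l.tail, ¬A w x) : cnt A w l ≤ l.length + 1 := by
  cases l with
  | nil => simp [cnt]
  | cons x l =>
    have := cnt_out h
    have := ind_le (A w x); have := ind_le (A x w)
    simp [cnt] at *; omega

theorem Pa.append {a b c d : V} {l l' : List V} (h : Pa A a b l) (hbc : A b c)
    (h' : Pa A c d l') : Pa A a d (l ++ l') := by
  induction h with
  | one a => exact .cons hbc h'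
  | cons hab _ ih => exact .cons hab (ih hbc)

theorem Pa.head {a b x : V} {l : List V} (h : Pa A a b (x :: l)) : x = a := by
  cases h <;> rfl

theorem Pa.ne {a b : V} (h : Pa A a b []) : False := by cases h

theorem Pa.cases_cons {a b x y : V} {l : List V} (h : Pa A a b (x :: y :: l)) :
    x = a ∧ A a y ∧ Pa A y b (y :: l) := by
  cases h with
  | cons h1 h2 => obtain rfl := h2.head; exact ⟨rfl, h1, h2⟩

theorem Pa.mem_left {a b : V} {l : List V} (h : Pa A a b l) : a ∈ l := by
  cases h <;> simp
theorem Pa.mem_right {a b : V} {l : List V} (h : Pa A a b l) : b ∈ l := by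
  induction h with
  | one => simp
  | cons _ _ ih => simp [ih]

theorem Pa.eq_cons {a b : V} {l : List V} (h : Pa A a b l) : ∃ t, l = a :: t := by
  cases h <;> exact ⟨_, rfl⟩
theorem Pa.eq_snoc {a b : V} {l : List V} (h : Pa A a b l) : ∃ t, l = t ++ [b] := by
  induction h with
  | one a => exact ⟨[], rfl⟩
  | @cons a _ _ _ _ _ ih => obtain ⟨t, rfl⟩ := ih; exact ⟨a :: t, rfl⟩

theorem Pa.split {a d p : V} {l1 l2 : List V} (h : Pa A a d (l1 ++ p :: l2)) :
    Pa A a p (l1 ++ [p]) ∧ Pa A p d (p :: l2) := by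
  induction l1 generalizing a with
  | nil =>
    obtain rfl := Pa.head h
    exact ⟨.one _, h⟩
  | cons x l1 ih =>
    obtain rfl := Pa.head h
    rw [List.cons_append] at h
    generalize hM : l1 ++ p :: l2 = M at h
    cases h with
    | one => simp at hM
    | cons h1 h2 => subst hM; exact ⟨.cons h1 (ih h2).1, (ih h2).2⟩

theorem Pa.split' {a d p q : V} {l1 l2 : List V} (h : Pa A a d (l1 ++ p :: q :: l2)) :
    Pa A a p (l1 ++ [p]) ∧ A p q ∧ Pa A q d (q :: l2) := by
  obtain ⟨h1, h2⟩ := h.split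
  exact ⟨h1, h2.cases_cons.2⟩

theorem Pa.insert {a d p q w : V} {l1 l2 : List V} (h : Pa A a d (l1 ++ p :: q :: l2))
    (hp : A p w) (hq : A w q) : Pa A a d (l1 ++ p :: w :: q :: l2) := by
  obtain ⟨h1, _, h3⟩ := h.split'
  have := h1.append hp (Pa.cons hq h3)
  simpa using this

theorem Lk.append {e z f : V} {Z1 Z2 : List V} :
    Lk A e (Z1 ++ z :: Z2) f ↔ Lk A e Z1 z ∧ Lk A z Z2 f := by
  induction Z1 generalizing e with
  | nil => simp [Lk]
  | cons x Z1 ih => simp [Lk, ih, and_assoc]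

/-- extend a path by a link -/
theorem Pa.snoc {f e z : V} {Q Z : List V} (h : Pa A f e Q) (hl : Lk A e Z z) :
    Pa A f z (Q ++ Z ++ [z]) := by
  induction Z generalizing e Q with
  | nil => simpa using h.append hl (.one z)
  | cons x Z ih =>
    obtain ⟨h1, h2⟩ := hl
    have := ih (h.append h1 (.one x)) h2
    simpa using this

theorem Lk.front {z f e : V} {Q Z : List V} (hl : Lk A z Z f) (h : Pa A f e Q) :
    Pa A z e (z :: Z ++ Q) := by
  induction Z generalizing z with
  | nil => exact .cons hl h
  | cons x Z ih => exact .cons hl.1 (ih hl.2)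

theorem Cyc.mk' {f e : V} {Q Z : List V} (h : Pa A f e Q) (hl : Lk A e Z f) : Cyc A (Q ++ Z) := by
  rcases List.eq_nil_or_concat Z with rfl | ⟨Z', z, rfl⟩
  · exact ⟨f, e, by simpa using h, hl⟩
  · rw [List.concat_eq_append] at *
    rw [Lk.append] at hl
    exact ⟨f, z, by simpa using h.snoc hl.1, hl.2⟩

theorem Pa.lk {a b g h : V} {l : List V} (hp : Pa A a b l) (h1 : A g a) (h2 : A b h) :
    Lk A g l h := by
  induction hp generalizing g with
  | one a => exact ⟨h1, h2⟩
  | cons hab _ ih => exact ⟨h1, ih hab h2⟩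

/-- path + closing arc gives a link after removing the head -/
theorem Pa.lk_tail {a b h : V} {l : List V} (hp : Pa A a b (a :: l)) (h2 : A b h) :
    Lk A a l h := by
  cases hp with
  | one => exact h2
  | cons h1 h3 => exact h3.lk h1 h2

theorem Cyc.rotate {L : List V} (h : Cyc A L) {c : V} (hc : c ∈ L) :
    ∃ T, Lk A c T c ∧ (c :: T).Perm L := by
  obtain ⟨f, e, hp, hef⟩ := h
  obtain ⟨s, t, rfl⟩ := List.append_of_mem hc
  obtain ⟨h1, h2⟩ := hp.split
  refine ⟨t ++ s, ?_, ?_⟩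
  · cases s with
    | nil =>
      obtain rfl := Pa.head h1
      simpa using h2.lk_tail hef
    | cons x s =>
      obtain rfl := Pa.head h1
      rw [Lk.append]
      refine ⟨h2.lk_tail hef, ?_⟩
      rcases Pa.eq_cons h1 with ⟨_, _⟩
      cases s with
      | nil => exact h1.cases_cons.2.1
      | cons y s =>
        obtain ⟨_, h5, h6⟩ := h1.cases_cons
        rcases List.eq_nil_or_concat s with rfl | ⟨s', z, rfl⟩
        · exact ⟨h5, h6.cases_cons.2.1⟩
        · rw [List.concat_eq_append] at *
          have h6' : Pa A y c ((y :: s') ++ z :: [c]) := by simpa using h6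
          obtain ⟨h7, h8, _⟩ := h6'.split'
          have := h7.lk h5 h8
          simpa using this
  · have := List.perm_append_comm (l₁ := c :: t) (l₂ := s)
    simpa using this

theorem Lk.pa {c : V} {T : List V} (h : Lk A c T c) : ∃ e, Pa A c e (c :: T) ∧ A e c := by
  rcases List.eq_nil_or_concat T with rfl | ⟨Z', z, rfl⟩
  · exact ⟨c, .one c, h⟩
  · rw [List.concat_eq_append] at *
    rw [Lk.append] at h
    exact ⟨z, by simpa using (Pa.one c).snoc h.1, h.2⟩

theorem cnt_ins {f e w : V} {Q : List V} (h : Pa A f e Q) (hw : ¬Ins A w Q) :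
    cnt A w Q + 1 ≤ Q.length + ind (A w f) + ind (A e w) := by
  induction h with
  | one a => simp [cnt]
  | @cons a b c l hab hp ih =>
    obtain ⟨t, rfl⟩ := hp.eq_cons
    have ih := ih (fun ⟨Q1, p, q, Q2, h1, h2⟩ => hw ⟨a :: Q1, p, q, Q2, by simp [h1], h2⟩)
    have : ¬(A a w ∧ A w b) := fun hh => hw ⟨[], a, b, t, rfl, hh⟩
    have a1 : ind (A a w) + ind (A w b) ≤ 1 := by
      unfold ind; split <;> split <;> simp_all
    simp [cnt] at *; omega

theorem Pa.ins {f e w : V} {Q : List V} (h : Pa A f e Q) (hw : Ins A w Q) :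
    ∃ Q', Pa A f e Q' ∧ Q'.Perm (w :: Q) := by
  obtain ⟨Q1, p, q, Q2, rfl, h1, h2⟩ := hw
  refine ⟨_, h.insert h1 h2, ?_⟩
  have := List.perm_middle (a := w) (l₁ := Q1 ++ [p]) (l₂ := q :: Q2)
  simpa using this

theorem walk {f e w p : V} {Q : List V} (h : Pa A f e Q) (hp : p ∈ Q) (hpw : A p w)
    (hw : ¬Ins A w Q) :
    A e w ∨ ∃ q ∈ Q, ¬A q w ∧ ¬A w q ∧ ∃ c, A c q ∧ A c w := by
  induction h generalizing p with
  | one a => simp at hp; subst hp; exact .inl hpw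
  | @cons a b c l hab hpa ih =>
    have hw' : ¬Ins A w l :=
      fun ⟨Q1, p, q, Q2, h1, h2⟩ => hw ⟨a :: Q1, p, q, Q2, by simp [h1], h2⟩
    have key : (∃ p ∈ l, A p w) ∨ ∃ q ∈ l, ¬A q w ∧ ¬A w q ∧ ∃ c, A c q ∧ A c w := by
      rcases List.mem_cons.1 hp with rfl | hp
      · obtain ⟨t, rfl⟩ := hpa.eq_cons
        have : ¬A w b := fun hh => hw ⟨[], p, b, t, rfl, hpw, hh⟩
        by_cases hb : A b w
        · exact .inl ⟨b, by simp, hb⟩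
        · exact .inr ⟨b, by simp, hb, this, p, hab, hpw⟩
      · exact .inl ⟨p, hp, hpw⟩
    rcases key with ⟨p', h1, h2⟩ | ⟨q, h1, h2⟩
    · rcases ih h1 h2 hw' with h3 | ⟨q, h3, h4⟩
      · exact .inl h3
      · exact .inr ⟨q, by simp [h3], h4⟩
    · exact .inr ⟨q, by simp [h1], h2⟩

end
section
variable {V : Type*} {A : V → V → Prop}

theorem cnt_eq_length [DecidableEq V] [DecidableRel A] (w : V) (L : List V) (h : L.Nodup) :
    cnt A w L = (L.toFinset.filter (fun x => A w x)).card
      + (L.toFinset.filter (fun x => A x w)).card := by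
  induction L with
  | nil => simp [cnt]
  | cons x l ih =>
    rw [List.nodup_cons] at h
    simp only [cnt, ih h.2, List.toFinset_cons, Finset.filter_insert]
    have hx : x ∉ l.toFinset := by simpa using h.1
    unfold ind
    split <;> split <;> simp_all <;> omega

theorem deg_eq [Fintype V] {L : List V} (h : Full L) (w : V) : deg A w = cnt A w L := by
  classical
  rw [cnt_eq_length w L h.1]
  have : L.toFinset = Finset.univ := by ext v; simp [h.2 v]
  rw [this]
  simp [deg, outDeg, inDeg, Nat.card_eq_fintype_card, Fintype.card_subtype]

theorem Full.length [Fintype V] {L : List V} (h : Full L) : L.length = Fintype.card V := by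
  classical
  have : L.toFinset = Finset.univ := by ext v; simp [h.2 v]
  rw [← List.toFinset_card_of_nodup h.1, this, Finset.card_univ]

theorem nodup_len [Fintype V] {L : List V} (h : L.Nodup) : L.length ≤ Fintype.card V := by
  classical
  rw [← List.toFinset_card_of_nodup h]; exact Finset.card_le_univ _

theorem exists_full [Fintype V] {L : List V} (h : L.Nodup) : ∃ W, Full (L ++ W) := by
  classical
  refine ⟨(Finset.univ \ L.toFinset).toList, ?_, ?_⟩
  · rw [List.nodup_append]
    refine ⟨h, Finset.nodup_toList _, ?_⟩
    intro a ha b hb hab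
    subst hab
    simp at hb; exact hb ha
  · intro v; simp; tauto

theorem full_of_len [Fintype V] {L : List V} (h : L.Nodup) (hl : L.length = Fintype.card V) :
    Full L := by
  obtain ⟨W, hW⟩ := exists_full h
  have := hW.length
  simp at this
  have : W = [] := by rw [← List.length_eq_zero_iff]; omega
  subst this; simpa using hW

theorem Full.perm {L L' : List V} (h : Full L) (hp : L.Perm L') : Full L' :=
  ⟨hp.nodup_iff.1 h.1, fun v => hp.mem_iff.1 (h.2 v)⟩

/-- working form of (*) -/
def Star [Fintype V] (A : V → V → Prop) : Prop :=
  ∀ x y u : V, x ≠ y → ¬A x y → ¬A y x → A u x → A u y →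
    2 * Fintype.card V ≤ deg A x + deg A y + 1 ∧
      Fintype.card V ≤ deg A x + 1 ∧ Fintype.card V ≤ deg A y + 1

/-- bypass structure -/
def Byp (A : V → V → Prop) (Q Z U : List V) (f e : V) : Prop :=
  Pa A f e Q ∧ Lk A e Z f ∧ Lk A e U f ∧ U ≠ [] ∧ (Q ++ Z ++ U).Nodup

theorem Byp.shrink1 {Q Z1 Z2 U U1 U2 : List V} {f e z u : V}
    (h : Byp A Q (Z1 ++ z :: Z2) U f e) (hU : U = U1 ++ u :: U2) (hz : A z u) :
    Byp A (Q ++ Z1 ++ [z]) Z2 (u :: U2) f z := by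
  obtain ⟨h1, h2, h3, h4, h5⟩ := h
  subst hU
  rw [Lk.append] at h2 h3
  refine ⟨h1.snoc h2.1, h2.2, ⟨hz, h3.2⟩, by simp, ?_⟩
  refine h5.sublist ?_
  simp

theorem Byp.shrink2 {Q Z1 Z2 U U1 U2 : List V} {f e z u : V}
    (h : Byp A Q (Z1 ++ z :: Z2) U f e) (hU : U = U1 ++ u :: U2) (hz : A u z) :
    Byp A (z :: Z2 ++ Q) Z1 (U1 ++ [u]) z e := by
  obtain ⟨h1, h2, h3, h4, h5⟩ := h
  subst hU
  rw [Lk.append] at h2 h3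
  refine ⟨h2.2.front h1, h2.1, ?_, by simp, ?_⟩
  · rw [Lk.append]; exact ⟨h3.1, hz⟩
  · have h6 : (z :: Z2 ++ Q ++ Z1 ++ (U1 ++ [u])).Perm (Q ++ (Z1 ++ z :: Z2) ++ (U1 ++ [u])) := by
      refine List.Perm.append_right _ ?_
      classical
      rw [List.perm_iff_count]; intro a; simp [List.count_cons]; omega
    rw [h6.nodup_iff]
    refine h5.sublist ?_
    simp

theorem lemma1 [Fintype V] (hirr : ∀ v, ¬A v v) (hst : Star A) {Q Z U : List V} {f e : V}
    (hb : Byp A Q Z U f e)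
    (hmin : ∀ Q' Z' U' f' e', Byp A Q' Z' U' f' e' → Q'.length + Z'.length = Q.length + Z.length →
      Z.length ≤ Z'.length) :
    (∃ Q', Pa A f e Q' ∧ Q'.Perm (Q ++ Z)) ∧
    (Z ≠ [] → ∃ y U', U = y :: U' ∧ A e y ∧ cnt A y Z = 0 ∧ Fintype.card V ≤ deg A y + 1
      ∧ ¬ Ins A y Q) := by
  obtain ⟨y, U', rfl⟩ : ∃ y U', U = y :: U' := by
    cases U with
    | nil => exact absurd rfl hb.2.2.2.1
    | cons y U' => exact ⟨_, _, rfl⟩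
  have hey : A e y := hb.2.2.1.1
  -- nonadjacency of Z and U
  have hna : ∀ z ∈ Z, ∀ u ∈ y :: U', ¬A z u ∧ ¬A u z := by
    intro z hz u hu
    obtain ⟨Z1, Z2, rfl⟩ := List.append_of_mem hz
    obtain ⟨U1, U2, hU⟩ := List.append_of_mem hu
    constructor
    · intro h
      have := hmin _ _ _ _ _ (hb.shrink1 hU h) (by simp; omega)
      simp at this; omega
    · intro h
      have := hmin _ _ _ _ _ (hb.shrink2 hU h) (by simp; omega)
      simp at this
  have hnd := hb.2.2.2.2
  obtain ⟨W, hW⟩ := exists_full hnd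
  have hn := hW.length
  by_cases hZ : Z = []
  · subst hZ; exact ⟨⟨Q, hb.1, by simp⟩, fun h => absurd rfl h⟩
  -- y not insertable
  have hyQ : ¬Ins A y Q := by
    rintro ⟨Q1, p, q, Q2, rfl, h1, h2⟩
    obtain ⟨g1, _, g3⟩ := hb.1.split'
    have : Byp A (q :: Q2 ++ Z ++ (Q1 ++ [p])) [] [y] q p := by
      refine ⟨?_, ?_, ⟨h1, h2⟩, by simp, ?_⟩
      · cases Z with
        | nil => exact absurd rfl hZ
        | cons z Z =>
          have := (g3.append hb.2.1.1 (hb.2.1.2.front g1))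
          simpa using this
      · exact (hb.1.split').2.1
      · have h6 : (q :: Q2 ++ Z ++ (Q1 ++ [p]) ++ [] ++ [y]).Perm
            ((Q1 ++ p :: q :: Q2) ++ Z ++ [y]) := by
          classical
          rw [List.perm_iff_count]; intro a; simp [List.count_cons]; omega
        rw [h6.nodup_iff]
        refine hnd.sublist ?_
        simp
    have := hmin _ _ _ _ _ this (by simp; omega)
    simp at this; exact hZ this
  have hZy : cnt A y Z = 0 := cnt_zero fun z hz => (hna z hz y (by simp)).symm
  -- no 2-paths through W
  have hWp : ∀ w ∈ Z, ∀ v ∈ W, ¬(A w v ∧ A v y) ∧ ¬(A y v ∧ A v w) := by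
    intro w hw v hv
    obtain ⟨Z1, Z2, rfl⟩ := List.append_of_mem hw
    obtain ⟨h1, h2, h3, h4, h5⟩ := hb
    rw [Lk.append] at h2
    have hfn : (Q ++ (Z1 ++ w :: Z2) ++ y :: U' ++ [v]).Nodup := by
      refine hW.1.sublist ?_
      refine List.Sublist.append (List.Sublist.refl _) ?_
      simpa using hv
    constructor
    · rintro ⟨g1, g2⟩
      have : Byp A (Q ++ Z1 ++ [w]) Z2 (v :: y :: U') f w := by
        refine ⟨h1.snoc h2.1, h2.2, ⟨g1, g2, h3.2⟩, by simp, ?_⟩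
        have h6 : ((Q ++ Z1 ++ [w]) ++ Z2 ++ (v :: y :: U')).Perm
            (Q ++ (Z1 ++ w :: Z2) ++ y :: U' ++ [v]) := by
          classical
          rw [List.perm_iff_count]; intro a; simp [List.count_cons]; omega
        rw [h6.nodup_iff]; exact hfn
      have := hmin _ _ _ _ _ this (by simp; omega)
      simp at this; omega
    · rintro ⟨g1, g2⟩
      have : Byp A (w :: Z2 ++ Q) Z1 [y, v] w e := by
        refine ⟨h2.2.front h1, h2.1, ⟨h3.1, g1, g2⟩, by simp, ?_⟩
        have h6 : (w :: Z2 ++ Q ++ Z1 ++ [y, v]).Perm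
            (Q ++ (Z1 ++ w :: Z2) ++ [y] ++ [v]) := by
          classical
          rw [List.perm_iff_count]; intro a; simp [List.count_cons]; omega
        rw [h6.nodup_iff]
        refine hfn.sublist ?_
        simp
      have := hmin _ _ _ _ _ this (by simp; omega)
      simp at this
  have hne : ∀ w ∈ Z, y ≠ w := by
    rintro w hw rfl
    rw [List.nodup_append] at hnd
    exact hnd.2.2 y (by simp [hw]) y (by simp) rfl
  have hdy : Fintype.card V ≤ deg A y + 1 := by
    obtain ⟨z, Z', rfl⟩ := List.exists_cons_of_ne_nil hZ
    have := hna z (by simp) y (by simp)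
    exact (hst y z e (hne z (by simp)) this.2 this.1 hey hb.2.1.1).2.1
  refine ⟨?_, fun _ => ⟨y, U', rfl, hey, hZy, hdy, hyQ⟩⟩
  have hdegy := deg_eq (A := A) hW y
  have hcyQ := cnt_ins hb.1 hyQ
  have i1 := ind_le (A y f); have i2 := ind_le (A e y)
  have hcyU := cnt_self (A := A) hirr (w := y) (l := y :: U') (by simp)
  -- induction
  have main : ∀ Z2 Z1, Z = Z1 ++ Z2 → (∃ Q', Pa A f e Q' ∧ Q'.Perm (Q ++ Z1)) →
      ∃ Q', Pa A f e Q' ∧ Q'.Perm (Q ++ Z) := by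
    intro Z2
    induction Z2 with
    | nil => intro Z1 h1 h2; simp at h1; subst h1; exact h2
    | cons w Z3 ih =>
      rintro Z1 h1 ⟨Q', hp, hperm⟩
      apply ih (Z1 ++ [w]) (by simp [h1])
      have hwZ : w ∈ Z := by simp [h1]
      by_cases hins : Ins A w Q'
      · obtain ⟨Q'', g1, g2⟩ := hp.ins hins
        refine ⟨Q'', g1, g2.trans ?_⟩
        have := (hperm.cons w).trans (List.perm_append_singleton w (Q ++ Z1)).symm
        simpa using this
      exfalso
      have hlen := hperm.length_eq
      have c1 := cnt_ins hp hins
      have i3 := ind_le (A w f); have i4 := ind_le (A e w)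
      have c2 := cnt_perm (A := A) w hperm
      have hdegw := deg_eq (A := A) hW w
      have c3 := cnt_self (A := A) hirr (w := w) (l := w :: Z3) (by simp)
      have c4 : cnt A w (y :: U') = 0 := cnt_zero fun u hu => hna w hwZ u hu
      have c5 := cnt_pair (A := A) (hWp w hwZ)
      subst h1
      simp only [cnt_append, List.length_append] at *
      simp only [List.length_cons] at *
      have hsum : deg A w + deg A y + 2 + Z1.length ≤ 2 * Fintype.card V := by omega
      have hpr : ∃ p ∈ Q', A p w ∧ (Z1 = [] → p = e) := by
        rcases List.eq_nil_or_concat Z1 with rfl | ⟨Z', z, rfl⟩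
        · exact ⟨e, hp.mem_right, hb.2.1.1, fun _ => rfl⟩
        · refine ⟨z, hperm.mem_iff.2 (by simp), ?_, by simp⟩
          have := hb.2.1
          simp only [List.concat_eq_append, List.append_assoc, List.singleton_append, Lk.append] at this
          exact this.2.1
      have hcom : ¬A e w := by
        intro hew
        have g := hna w hwZ y (by simp)
        have := (hst y w e (hne w hwZ) g.2 g.1 hey hew).1
        omega
      obtain ⟨p, hpQ, hpw, hpe⟩ := hpr
      rcases walk hp hpQ hpw hins with g | ⟨q, hq, g1, g2, c, g3, g4⟩
      · exact hcom g
      · by_cases hZ1 : Z1 = []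
        · exact hcom (hpe hZ1 ▸ hpw)
        · have : 0 < Z1.length := List.length_pos_iff.2 hZ1
          have hqw : q ≠ w := by
            rintro rfl
            have hq' := hperm.mem_iff.1 hq
            rw [List.nodup_append, List.nodup_append] at hnd
            rcases List.mem_append.1 hq' with hq' | hq'
            · exact hnd.1.2.2 q hq' q (by simp) rfl
            · have := hnd.1.2.1
              rw [List.nodup_append] at this
              exact this.2.2 q hq' q (by simp) rfl
          have := (hst q w c hqw g1 g2 g3 g4).2.2
          omega
  exact main Z [] rfl ⟨Q, hb.1, by simp⟩

end
section
variable {V : Type*} {A : V → V → Prop}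

theorem ret {L : List V} {c0 : V} (hc0 : c0 ∈ L) {u : V} (hr : Relation.ReflTransGen A u c0)
    (hu : u ∉ L) :
    ∃ w U c, Pa A u w U ∧ A w c ∧ c ∈ L ∧ U.Nodup ∧ ∀ x ∈ U, x ∉ L := by
  induction hr using Relation.ReflTransGen.head_induction_on with
  | refl => exact absurd hc0 hu
  | @head a b hab _ ih =>
    by_cases hb : b ∈ L
    · exact ⟨a, [a], b, .one a, hab, hb, by simp, by simpa using hu⟩
    · obtain ⟨w, U, c, h1, h2, h3, h4, h5⟩ := ih hb
      by_cases ha : a ∈ U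
      · obtain ⟨s, t, rfl⟩ := List.append_of_mem ha
        refine ⟨w, a :: t, c, h1.split.2, h2, h3, h4.sublist (by simp), ?_⟩
        intro x hx; exact h5 x (by simp at hx ⊢; tauto)
      · refine ⟨w, a :: U, c, .cons hab h1, h2, h3, by simp [ha, h4], ?_⟩
        intro x hx
        rcases List.mem_cons.1 hx with rfl | hx
        · exact hu
        · exact h5 x hx

theorem escape {L : List V} {c0 v : V} (hc0 : c0 ∈ L) (hr : Relation.ReflTransGen A c0 v)
    (hv : v ∉ L) : ∃ c u, c ∈ L ∧ u ∉ L ∧ A c u := by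
  by_contra hcon
  push Not at hcon
  apply hv
  induction hr with
  | refl => exact hc0
  | @tail b c _ hbc ih =>
    by_contra hc
    have hb : b ∈ L := by
      by_contra hb
      exact hb (ih hb)
    exact hcon b c hb hc hbc

theorem ear (hs : IsStrong A) {L : List V} (hc : Cyc A L) (hnd : L.Nodup) {v : V} (hv : v ∉ L) :
    ∃ Q Z U f e, Byp A Q Z U f e ∧ (Q ++ Z).Perm L := by
  have hc' := hc
  obtain ⟨c0, _, hp0, _⟩ := hc'
  obtain ⟨c, u, h1, h2, h3⟩ := escape hp0.mem_left (hs c0 v) hv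
  obtain ⟨w, U, f, g1, g2, g3, g4, g5⟩ := ret h1 (hs u c) h2
  obtain ⟨T, k1, k2⟩ := hc.rotate g3
  have hU : Lk A c U f := g1.lk h3 g2
  have hUne : U ≠ [] := by rintro rfl; exact g1.ne
  have hdis : ∀ M : List V, M.Perm L → (M ++ U).Nodup := by
    intro M hM
    rw [List.nodup_append]
    refine ⟨hM.nodup_iff.2 hnd, g4, ?_⟩
    rintro a ha b hb rfl
    exact g5 a hb (hM.mem_iff.1 ha)
  have hcT := k2.mem_iff.2 h1
  rcases List.mem_cons.1 hcT with rfl | hcT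
  · refine ⟨[c], T, U, c, c, ⟨.one c, k1, hU, hUne, hdis _ (by simpa using k2)⟩, by simpa using k2⟩
  · obtain ⟨T1, T2, rfl⟩ := List.append_of_mem hcT
    rw [Lk.append] at k1
    have hperm : ([f] ++ T1 ++ [c] ++ T2).Perm L := by simpa using k2
    exact ⟨[f] ++ T1 ++ [c], T2, U, f, c,
      ⟨(Pa.one f).snoc k1.1, k1.2, hU, hUne, hdis _ hperm⟩, hperm⟩

theorem init_cycle [Fintype V] (hs : IsStrong A) (hirr : ∀ v, ¬A v v)
    (hout : ∀ v x, ∃ w, w ≠ x ∧ A v w) (v : V) :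
    ∃ L, Cyc A L ∧ L.Nodup ∧ L.length + 1 ≤ Fintype.card V := by
  obtain ⟨w1, hw1v, hw1⟩ := hout v v
  obtain ⟨w2, hw12, hw2⟩ := hout v w1
  obtain ⟨w, U, c, g1, g2, g3, g4, g5⟩ := ret (L := [v]) (c0 := v) (by simp) (hs w1 v) (by simpa using hw1v)
  simp at g3; subst g3
  have hnd : ([c] ++ U).Nodup := by
    simp [g4]; intro h; exact g5 c h (by simp)
  by_cases hlen : ([c] ++ U).length + 1 ≤ Fintype.card V
  · exact ⟨_, Cyc.mk' (Pa.one c) (g1.lk hw1 g2), hnd, hlen⟩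
  have hle := nodup_len hnd
  have hf := full_of_len hnd (by omega)
  have hm := hf.2 w2
  have hw2c : w2 ≠ c := by rintro rfl; exact hirr _ hw2
  have hm : w2 ∈ U := by simpa [hw2c] using hm
  obtain ⟨s, t, rfl⟩ := List.append_of_mem hm
  obtain ⟨y, hy⟩ : ∃ x s', s = x :: s' := by
    cases s with
    | nil => exact absurd (Pa.head g1) hw12
    | cons x s => exact ⟨_, _, rfl⟩
  obtain ⟨s', rfl⟩ := hy
  refine ⟨[c] ++ w2 :: t, Cyc.mk' (Pa.one c) (g1.split.2.lk hw2 g2), ?_, ?_⟩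
  · refine hnd.sublist ?_
    exact List.Sublist.append (List.Sublist.refl _) (by simp)
  · simp at hle ⊢; omega

theorem lemmaB [Fintype V] (hs : IsStrong A) (hirr : ∀ v, ¬A v v) (hst : Star A) {m : ℕ}
    (hm : m + 2 ≤ Fintype.card V)
    (hmax : ∀ L, Cyc A L → L.Nodup → L.length ≤ m ∨ L.length = Fintype.card V)
    {L : List V} (hc : Cyc A L) (hnd : L.Nodup) (hlen : L.length = m) :
    ∃ Q U f e, Pa A f e Q ∧ A e f ∧ Lk A e U f ∧ Full (Q ++ U) ∧ Q.length = m := by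
  classical
  have hex : ∃ g, ∃ Q Z U f e, Byp A Q Z U f e ∧ Q.length + Z.length = m ∧ Z.length = g := by
    have : ∃ v, v ∉ L := by
      by_contra hcon
      push Not at hcon
      have := Full.length ⟨hnd, hcon⟩
      omega
    obtain ⟨v, hv⟩ := this
    obtain ⟨Q, Z, U, f, e, h1, h2⟩ := ear hs hc hnd hv
    refine ⟨_, Q, Z, U, f, e, h1, ?_, rfl⟩
    have := h2.length_eq; simp at this; omega
  let g := Nat.find hex
  obtain ⟨Q, Z, U, f, e, hb, hQZ, hZg⟩ : ∃ Q Z U f e, Byp A Q Z U f e ∧ Q.length + Z.length = m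
    ∧ Z.length = g := Nat.find_spec hex
  have hgmin : ∀ Q' Z' U' f' e', Byp A Q' Z' U' f' e' → Q'.length + Z'.length = m →
      g ≤ Z'.length := fun Q' Z' U' f' e' h1 h2 => Nat.find_min' hex ⟨Q', Z', U', f', e', h1, h2, rfl⟩
  clear_value g
  clear hex hc hnd hlen
  subst hZg
  -- every min gap bypass is spanning
  have hspan : ∀ Q' Z' U' f' e', Byp A Q' Z' U' f' e' → Q'.length + Z'.length = m →
      Z'.length = Z.length → m + U'.length = Fintype.card V := by
    intro Q' Z' U' f' e' h1 h2 h3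
    obtain ⟨⟨R, k1, k2⟩, _⟩ := lemma1 hirr hst h1
      (fun a b c d e h h' => by rw [h3]; exact hgmin a b c d e h (by omega))
    have hU := k2.append_right U'
    have := hmax _ (Cyc.mk' k1 h1.2.2.1) (hU.nodup_iff.2 h1.2.2.2.2)
    have hl := hU.length_eq
    have h0 : U'.length ≠ 0 := by simpa using h1.2.2.2.1
    simp only [List.length_append] at this hl; omega
  have hr := hspan _ _ _ _ _ hb hQZ rfl
  by_cases hZ : Z = []
  · subst hZ
    refine ⟨Q, U, f, e, hb.1, hb.2.1, hb.2.2.1, ?_, by simpa using hQZ⟩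
    have h := hb.2.2.2.2
    simp only [List.append_nil] at h
    exact full_of_len h (by simp only [List.length_append, List.length_nil] at *; omega)
  exfalso
  have hZpos : 0 < Z.length := List.length_pos_iff.2 hZ
  -- gap
  have hgap := hmax _ (Cyc.mk' hb.1 hb.2.2.1) (hb.2.2.2.2.sublist (by simp))
  obtain ⟨y, U', rfl, hey, hyZ, hdy, hyI⟩ := (lemma1 hirr hst hb
      (fun a b c d e h h' => hgmin a b c d e h (by omega))).2 hZ
  obtain ⟨h1, h2, h3, h4, h5⟩ := hb
  have hnot : ∀ U1 v U2, U' = U1 ++ v :: U2 → U1 ≠ [] → ¬A y v := by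
    rintro U1 v U2 rfl hU1 hyv
    have h3' := h3.2
    rw [Lk.append] at h3'
    have := hspan Q Z (y :: v :: U2) f e ⟨h1, h2, ⟨hey, hyv, h3'.2⟩, by simp, h5.sublist (by simp)⟩
      hQZ rfl
    have h0 : U1.length ≠ 0 := by simpa using hU1
    simp only [List.length_append, List.length_cons] at this hr; omega
  have hyf : ¬A y f := by
    intro hyf
    have := hspan Q Z [y] f e ⟨h1, h2, ⟨hey, hyf⟩, by simp, h5.sublist (by simp)⟩ hQZ rfl
    simp at this; omega
  have hf : Full (Q ++ Z ++ y :: U') := full_of_len h5 (by simp only [List.length_append, List.length_cons] at *; omega)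
  have hd := deg_eq (A := A) hf y
  have c1 := cnt_ins h1 hyI
  have c2 : cnt A y U' ≤ U'.length + 1 := by
    apply cnt_tail
    intro x hx
    cases U' with
    | nil => simp at hx
    | cons b U' =>
      obtain ⟨s, t, hst⟩ := List.append_of_mem hx
      simp at hst
      exact hnot (b :: s) x t (by simp [hst]) (by simp)
  have i1 := ind_le (A e y)
  rw [ind_neg hyf] at c1
  simp only [cnt_append, cnt, ind_neg (hirr y), List.length_cons, List.length_append] at hd c1 c2 hr hQZ hgap
  have c3 : Fintype.card V ≤ deg A y + 1 := hdy
  omega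

end

section
variable {V : Type*} {A : V → V → Prop}

noncomputable def sm (p : V → Prop) : List V → ℕ
  | [] => 0
  | x :: l => ind (p x) + sm p l

theorem cnt_sm (w : V) (l : List V) : cnt A w l = sm (fun x => A w x) l + sm (fun x => A x w) l := by
  induction l with
  | nil => rfl
  | cons x l ih => simp only [cnt, sm, ih]; omega

theorem sm_zero {p : V → Prop} {l : List V} (h : ∀ x ∈ l, ¬p x) : sm p l = 0 := by
  induction l with
  | nil => rfl
  | cons x l ih => simp [sm, ind_neg (h x (by simp)), ih (fun y hy => h y (by simp [hy]))]

theorem sm_le (p : V → Prop) (l : List V) : sm p l ≤ l.length := by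
  induction l with
  | nil => simp [sm]
  | cons x l ih => have := ind_le (p x); simp [sm]; omega

theorem sm_full {p : V → Prop} {l : List V} (h : l.length ≤ sm p l) : ∀ x ∈ l, p x := by
  induction l with
  | nil => simp
  | cons x l ih =>
    have h1 := ind_le (p x)
    have h2 := sm_le p l
    simp only [sm, List.length_cons] at h
    intro y hy
    rcases List.mem_cons.1 hy with rfl | hy
    · by_contra hn
      rw [ind_neg hn] at h; omega
    · exact ih (by omega) y hy

theorem sm_append (p : V → Prop) (l l' : List V) : sm p (l ++ l') = sm p l + sm p l' := by
  induction l with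
  | nil => simp [sm]
  | cons x l ih => simp [sm, ih]; omega

theorem sm_tail {p : V → Prop} {l : List V} (h : ∀ x ∈ l.tail, ¬p x) : sm p l ≤ 1 := by
  cases l with
  | nil => simp [sm]
  | cons x l =>
    have := ind_le (p x)
    have := sm_zero (p := p) (l := l) h
    simp [sm]; omega

theorem sm_last {p : V → Prop} {l : List V} (h : ∀ S v R, l = S ++ v :: R → R ≠ [] → ¬p v) :
    sm p l ≤ 1 := by
  rcases List.eq_nil_or_concat l with rfl | ⟨S, z, rfl⟩
  · simp [sm]
  · rw [List.concat_eq_append] at *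
    have h0 : sm p S = 0 := by
      apply sm_zero
      intro x hx
      obtain ⟨s, t, rfl⟩ := List.append_of_mem hx
      exact h s x (t ++ [z]) (by simp) (by simp)
    have := ind_le (p z)
    simp [sm_append, sm]; omega

theorem sm_pair {p q : V → Prop} {l : List V} (h : ∀ x ∈ l, ¬(p x ∧ q x)) :
    sm p l + sm q l ≤ l.length := by
  induction l with
  | nil => simp [sm]
  | cons x l ih =>
    have ih := ih (fun z hz => h z (by simp [hz]))
    have h1 := h x (by simp)
    have a1 : ind (p x) + ind (q x) ≤ 1 := by
      unfold ind; split <;> split <;> simp_all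
    simp [sm]; omega

theorem seg_aux {L : List V} {u : V} (k : ℕ) : ∀ (Q Z : List V) (f e : V), Z.length = k →
    Pa A f e Q → Lk A e Z f → (Q ++ Z).Perm L → A e u → A u f →
    ∃ Q Z f e, Pa A f e Q ∧ Lk A e Z f ∧ (Q ++ Z).Perm L ∧ A e u ∧ A u f ∧
      ∀ z ∈ Z, ¬A u z ∧ ¬A z u := by
  induction k using Nat.strong_induction_on with
  | _ k ih =>
    intro Q Z f e hk h1 h2 h3 h4 h5
    by_cases hz : ∀ z ∈ Z, ¬A u z ∧ ¬A z u
    · exact ⟨Q, Z, f, e, h1, h2, h3, h4, h5, hz⟩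
    push Not at hz
    obtain ⟨z, hzZ, hz⟩ := hz
    obtain ⟨Z1, Z2, rfl⟩ := List.append_of_mem hzZ
    rw [Lk.append] at h2
    simp only [List.length_append, List.length_cons] at hk
    by_cases huz : A u z
    · refine ih Z1.length (by omega) (z :: Z2 ++ Q) Z1 z e rfl (h2.2.front h1) h2.1 ?_ h4 huz
      refine List.Perm.trans ?_ h3
      have := List.perm_append_comm (l₁ := z :: Z2) (l₂ := Q ++ Z1)
      simpa using this
    · refine ih Z2.length (by omega) (Q ++ Z1 ++ [z]) Z2 f z rfl (h1.snoc h2.1) h2.2 ?_ (hz huz) h5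
      simpa using h3

theorem seg {L : List V} {u c c' : V} (hc : Cyc A L) (h1 : c ∈ L) (h2 : A c u) (h3 : c' ∈ L)
    (h4 : A u c') :
    ∃ Q Z f e, Pa A f e Q ∧ Lk A e Z f ∧ (Q ++ Z).Perm L ∧ A e u ∧ A u f ∧
      ∀ z ∈ Z, ¬A u z ∧ ¬A z u := by
  obtain ⟨T, k1, k2⟩ := hc.rotate h3
  have hcT := k2.mem_iff.2 h1
  rcases List.mem_cons.1 hcT with rfl | hcT
  · exact seg_aux _ [c] T c c rfl (.one c) k1 (by simpa using k2) h2 h4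
  · obtain ⟨T1, T2, rfl⟩ := List.append_of_mem hcT
    rw [Lk.append] at k1
    exact seg_aux _ ([c'] ++ T1 ++ [c]) T2 c' c rfl ((Pa.one c').snoc k1.1) k1.2
      (by simpa using k2) h2 h4

theorem L3 [Fintype V] (hirr : ∀ v, ¬A v v) (hst : Star A) {m : ℕ}
    (hm : m + 2 ≤ Fintype.card V)
    (hmax : ∀ L, Cyc A L → L.Nodup → L.length ≤ m ∨ L.length = Fintype.card V)
    {C U' : List V} {u w c c' : V} (hc : Cyc A C) (hlen : C.length = m) (hF : Full (C ++ u :: U'))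
    (hU : Pa A u w (u :: U')) (hns : ∀ x ∈ U'.tail, ¬A u x)
    (g1 : c ∈ C) (g2 : A c u) (g3 : c' ∈ C) (g4 : A u c') :
    U'.length = 1 ∧ ∃ Q z f e, Pa A f e Q ∧ (Q ++ [z]).Perm C ∧ A e z ∧ A z f ∧ A e u ∧ A u f ∧
      2 * Fintype.card V ≤ deg A u + deg A z + 1 := by
  obtain ⟨Q, Z, f, e, h1, h2, h3, h4, h5, h6⟩ := seg hc g1 g2 g3 g4
  have hF' : Full (Q ++ Z ++ u :: U') := hF.perm (h3.append_right _).symm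
  have hl := h3.length_eq
  have hn := hF'.length
  simp only [List.length_append, List.length_cons] at hl hn
  have hnd := hF'.1
  -- contradiction tool
  have bad : ∀ Q' Z', Pa A f e Q' → Lk A e Z' f → (Q' ++ Z').Subperm (Q ++ Z ++ u :: U') →
      m < Q'.length + Z'.length → Q'.length + Z'.length < Fintype.card V → False := by
    intro Q' Z' k1 k2 k3 k4 k5
    have hnd' : (Q' ++ Z').Nodup := by
      obtain ⟨l, p1, p2⟩ := k3
      exact p1.nodup_iff.1 (hnd.sublist p2)
    have := hmax _ (Cyc.mk' k1 k2) hnd'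
    simp only [List.length_append] at this
    omega
  -- subperm via counts
  classical
  have hsp : ∀ M : List V, (∀ a, M.count a ≤ (Q ++ Z ++ u :: U').count a) →
      M.Subperm (Q ++ Z ++ u :: U') := fun M h => List.subperm_iff_count.2 h
  have huQ : ¬Ins A u Q := by
    intro hi
    obtain ⟨Q', k1, k2⟩ := h1.ins hi
    have hk := k2.length_eq
    simp only [List.length_cons] at hk
    refine bad Q' Z k1 h2 (hsp _ ?_) (by omega) (by omega)
    intro a; simp only [List.count_append, List.count_cons, k2.count_eq]; omega
  have cu := cnt_ins h1 huQ
  rw [ind_pos h4, ind_pos h5] at cu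
  have du := deg_eq (A := A) hF' u
  have cuU := cnt_tail hns
  have hcz := cnt_zero (A := A) h6
  simp only [cnt_append, cnt, hcz, ind_neg (hirr u)] at du
  -- prefix path
  have hpre : ∀ S v R, U' = S ++ v :: R → Pa A u v (u :: S ++ [v]) := by
    intro S v R hS
    subst hS
    exact (Pa.split (l1 := u :: S) hU).1
  match Z, h2, h6 with
  | [], _, _ =>
    exfalso
    simp only [List.length_nil] at hl hn
    refine bad Q [u] h1 ⟨h4, h5⟩ (hsp _ ?_) (by simp; omega) (by simp; omega)
    intro a; simp only [List.count_append, List.count_cons, List.count_nil]; omega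
  | [z], h2, h6 =>
    obtain ⟨hez, hzf⟩ : A e z ∧ A z f := h2
    have hzu := h6 z (by simp)
    have hne : u ≠ z := by
      rintro rfl
      rw [List.nodup_append] at hnd
      exact hnd.2.2 u (by simp) u (by simp) rfl
    have hS := hst u z e hne hzu.1 hzu.2 h4 hez
    refine ⟨?_, Q, z, f, e, h1, h3, hez, hzf, h4, h5, hS.1⟩
    by_contra hU1
    simp only [List.length_cons, List.length_nil] at hl hn
    have hzQ : ¬Ins A z Q := by
      intro hi
      obtain ⟨Q', k1, k2⟩ := h1.ins hi
      have hk := k2.length_eq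
      simp only [List.length_cons] at hk
      refine bad Q' [u] k1 ⟨h4, h5⟩ (hsp _ ?_) (by simp; omega) (by simp; omega)
      intro a; simp only [List.count_append, List.count_cons, k2.count_eq, List.count_nil]; omega
    have cz := cnt_ins h1 hzQ
    rw [ind_pos hez, ind_pos hzf] at cz
    have dz := deg_eq (A := A) hF' z
    simp only [cnt_append, cnt, ind_neg (hirr z), ind_neg hzu.1, ind_neg hzu.2] at dz
    have s1 : sm (fun x => A u x) U' ≤ 1 := sm_tail hns
    have s2 : sm (fun x => A x z) U' ≤ 1 := by
      apply sm_last
      intro S v R hS hR hvz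
      have hk : Lk A e (u :: S ++ v :: [z]) f := by
        have := (hpre S v R hS).lk (g := e) (h := z) h4 hvz
        have := (Lk.append (Z1 := u :: S ++ [v]) (z := z) (Z2 := [])).2 ⟨this, hzf⟩
        simpa using this
      have hR0 : R.length ≠ 0 := by simpa using hR
      subst hS
      simp only [List.length_append, List.length_cons] at hn
      refine bad Q _ h1 hk (hsp _ ?_) (by simp; omega) (by simp; omega)
      intro a; simp only [List.count_append, List.count_cons, List.count_nil]; omega
    have s3 : sm (fun x => A z x) U' + sm (fun x => A x u) U' ≤ U'.length := by
      apply sm_pair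
      rintro v hv ⟨k1, k2⟩
      obtain ⟨S, R, rfl⟩ := List.append_of_mem hv
      simp only [List.length_append, List.length_cons] at hn hU1
      refine bad Q [z, v, u] h1 ⟨hez, k1, k2, h5⟩ (hsp _ ?_) (by simp; omega) (by simp; omega)
      intro a; simp only [List.count_append, List.count_cons, List.count_nil]; omega
    have e1 := cnt_sm (A := A) u U'
    have e2 := cnt_sm (A := A) z U'
    omega
  | [z, z'], h2, h6 =>
    exfalso
    obtain ⟨hez, hzz, hzf⟩ : A e z ∧ A z z' ∧ A z' f := h2
    have hzu := h6 z (by simp)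
    have hzu' := h6 z' (by simp)
    have hne : u ≠ z := by
      rintro rfl
      rw [List.nodup_append] at hnd
      exact hnd.2.2 u (by simp) u (by simp) rfl
    have hne' : u ≠ z' := by
      rintro rfl
      rw [List.nodup_append] at hnd
      exact hnd.2.2 u (by simp) u (by simp) rfl
    have hS := hst u z e hne hzu.1 hzu.2 h4 hez
    simp only [List.length_cons, List.length_nil] at hl hn
    have s1 : sm (fun x => A u x) U' ≤ 1 := sm_tail hns
    have e1 := cnt_sm (A := A) u U'
    have hall : ∀ x ∈ U', A x u := sm_full (p := fun x => A x u) (by omega)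
    have hzo : ∀ x ∈ U', ¬A z x := by
      intro v hv k1
      have k2 := hall v hv
      obtain ⟨S, R, rfl⟩ := List.append_of_mem hv
      simp only [List.length_append, List.length_cons] at hn
      refine bad Q [z, v, u] h1 ⟨hez, k1, k2, h5⟩ (hsp _ ?_) (by simp; omega) (by simp; omega)
      intro a; simp only [List.count_append, List.count_cons, List.count_nil]; omega
    have s0 := sm_zero (p := fun x => A z x) hzo
    have s2 : sm (fun x => A x z) U' ≤ 1 := by
      apply sm_last
      intro S v R hS hR hvz
      have hk : Lk A e (u :: S ++ v :: [z, z']) f := by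
        have := (hpre S v R hS).lk (g := e) (h := z) h4 hvz
        have := (Lk.append (Z1 := u :: S ++ [v]) (z := z) (Z2 := [z'])).2 ⟨this, hzz, hzf⟩
        simpa using this
      have hR0 : R.length ≠ 0 := by simpa using hR
      subst hS
      simp only [List.length_append, List.length_cons] at hn
      refine bad Q _ h1 hk (hsp _ ?_) (by simp; omega) (by simp; omega)
      intro a; simp only [List.count_append, List.count_cons, List.count_nil]; omega
    have s3 : sm (fun x => A x z') U' = 0 := by
      apply sm_zero
      intro v hv hvz
      obtain ⟨S, R, hS⟩ := List.append_of_mem hv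
      have hk : Lk A e (u :: S ++ v :: [z']) f := by
        have := (hpre S v R hS).lk (g := e) (h := z') h4 hvz
        have := (Lk.append (Z1 := u :: S ++ [v]) (z := z') (Z2 := [])).2 ⟨this, hzf⟩
        simpa using this
      subst hS
      simp only [List.length_append, List.length_cons] at hn
      refine bad Q _ h1 hk (hsp _ ?_) (by simp; omega) (by simp; omega)
      intro a; simp only [List.count_append, List.count_cons, List.count_nil]; omega
    have s4 : sm (fun x => A z' x) U' ≤ 1 := by
      by_cases hU1 : U'.length = 1
      · have := sm_le (fun x => A z' x) U'; omega
      rw [sm_zero]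
      · omega
      intro v hv k1
      have k2 := hall v hv
      obtain ⟨S, R, rfl⟩ := List.append_of_mem hv
      simp only [List.length_append, List.length_cons] at hn hU1
      refine bad Q [z, z', v, u] h1 ⟨hez, hzz, k1, k2, h5⟩ (hsp _ ?_) (by simp; omega) (by simp; omega)
      intro a; simp only [List.count_append, List.count_cons, List.count_nil]; omega
    have e2 := cnt_sm (A := A) z U'
    have e3 := cnt_sm (A := A) z' U'
    by_cases hi : Ins A z Q
    · obtain ⟨Q', k1, k2⟩ := h1.ins hi
      have hk := k2.length_eq
      simp only [List.length_cons] at hk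
      have hi' : ¬Ins A z' Q' := by
        intro hi'
        obtain ⟨Q'', k3, k4⟩ := k1.ins hi'
        have hk' := k4.length_eq
        simp only [List.length_cons] at hk'
        refine bad Q'' [u] k3 ⟨h4, h5⟩ (hsp _ ?_) (by simp; omega) (by simp; omega)
        intro a
        simp only [List.count_append, List.count_cons, k2.count_eq, k4.count_eq, List.count_nil]; omega
      have c1 := cnt_ins k1 hi'
      rw [ind_pos hzf] at c1
      have c2 := cnt_perm (A := A) z' k2
      have dz := deg_eq (A := A) hF' z'
      simp only [cnt_append, cnt, ind_neg (hirr z'), ind_neg hzu'.1, ind_neg hzu'.2] at dz c2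
      have hnz : z' ∉ Q' := by
        rw [k2.mem_iff]
        intro hz
        have : ([z'] ++ z :: Q).Subperm (Q ++ [z, z'] ++ u :: U') := hsp _ (by
          intro a; simp only [List.count_append, List.count_cons, List.count_nil]; omega)
        obtain ⟨l, p1, p2⟩ := this
        have := p1.nodup_iff.1 (hnd.sublist p2)
        rw [List.nodup_append] at this
        exact this.2.2 z' (by simp) z' hz rfl
      have i1 := ind_le (A e z')
      by_cases hez' : A e z'
      · have := hst u z' e hne' hzu'.1 hzu'.2 h4 hez'
        omega
      · rcases walk k1 (p := z) (k2.mem_iff.2 (by simp)) hzz hi' with h | ⟨q, q1, q2, q3, d, q4, q5⟩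
        · exact hez' h
        · have := hst q z' d (by rintro rfl; exact hnz q1) q2 q3 q4 q5
          rw [ind_neg hez'] at c1
          omega
    · have cz := cnt_ins h1 hi
      have dz := deg_eq (A := A) hF' z
      simp only [cnt_append, cnt, ind_neg (hirr z), ind_neg hzu.1, ind_neg hzu.2] at dz
      have i1 := ind_le (A z f)
      have i2 := ind_le (A e z)
      have i3 := ind_le (A z z')
      have i4 := ind_le (A z' z)
      have hU1 : U'.length = 1 := by omega
      obtain ⟨v, rfl⟩ := List.length_eq_one_iff.1 hU1
      simp only [sm] at e2 s0
      have hvz : A v z := by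
        by_contra h
        simp only [ind_neg h] at e2; omega
      have i5 := ind_le (A v z)
      have hzf' : A z f := by
        by_contra h
        simp only [ind_neg h] at cz; omega
      have huv : A u v := hU.cases_cons.2.1
      refine bad Q [u, v, z] h1 ⟨h4, huv, hvz, hzf'⟩ (hsp _ ?_) (by simp; omega) (by simp; omega)
      intro a; simp only [List.count_append, List.count_cons, List.count_nil]; omega
  | a :: b :: d :: Z', h2, h6 =>
    exfalso
    have hz := h6 a (by simp)
    have hne : u ≠ a := by
      rintro rfl
      rw [List.nodup_append] at hnd
      exact hnd.2.2 u (by simp) u (by simp) rfl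
    have hS := hst u a e hne hz.1 hz.2 h4 h2.1
    simp only [List.length_cons] at hl hn
    omega

end

section
variable {V : Type*} {A : V → V → Prop}

theorem Lk.toPa {e u f : V} {U : List V} (h : Lk A e (u :: U) f) : ∃ w, Pa A u w (u :: U) := by
  induction U generalizing e u with
  | nil => exact ⟨u, .one u⟩
  | cons x U ih =>
    obtain ⟨w, hw⟩ := ih h.2
    exact ⟨w, .cons h.2.1 hw⟩

/-- rotation of a cycle -/
def RR (A : V → V → Prop) (C : List V) (c : V) (T : List V) : Prop :=
  Lk A c T c ∧ (c :: T).Perm C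

theorem RR.rot {C S T : List V} {c d : V} (h : RR A C c (S ++ d :: T)) :
    RR A C d (T ++ c :: S) := by
  obtain ⟨h1, h2⟩ := h
  rw [Lk.append] at h1
  refine ⟨Lk.append.2 ⟨h1.2, h1.1⟩, ?_⟩
  refine List.Perm.trans ?_ h2
  have := List.perm_append_comm (l₁ := d :: T) (l₂ := c :: S)
  simpa using this

theorem RR.next {C S : List V} {c d : V} (h : RR A C c (d :: S)) : RR A C d (S ++ [c]) :=
  RR.rot (S := []) h

theorem RR.exists {C : List V} (hC : Cyc A C) {c : V} (hc : c ∈ C) : ∃ T, RR A C c T :=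
  hC.rotate hc

theorem RR.exists_succ (hirr : ∀ v, ¬A v v) {C : List V} (hC : Cyc A C) {c : V} (hc : c ∈ C) :
    ∃ d S, RR A C c (d :: S) := by
  obtain ⟨T, hT⟩ := RR.exists hC hc
  cases T with
  | nil => exact absurd hT.1 (hirr c)
  | cons d S => exact ⟨d, S, hT⟩

theorem RR.exists_pred (hirr : ∀ v, ¬A v v) {C : List V} (hC : Cyc A C) {d : V} (hd : d ∈ C) :
    ∃ c S, RR A C c (d :: S) := by
  obtain ⟨T, hT⟩ := RR.exists hC hd
  rcases List.eq_nil_or_concat T with rfl | ⟨S, c, rfl⟩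
  · exact absurd hT.1 (hirr d)
  · rw [List.concat_eq_append] at hT
    exact ⟨c, S, RR.rot (T := []) hT⟩

theorem RR.prop_aux {C : List V} {P : V → Prop}
    (hP : ∀ c d S, RR A C c (d :: S) → P c → P d) (S : List V) :
    ∀ c T, RR A C c (S ++ T) → P c → ∀ x ∈ S, P x := by
  induction S with
  | nil => simp
  | cons d S ih =>
    intro c T h hc x hx
    have hd := hP c d (S ++ T) h hc
    rcases List.mem_cons.1 hx with rfl | hx
    · exact hd
    · refine ih d (T ++ [c]) ?_ hd x hx
      have := RR.next (S := S ++ T) h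
      simpa using this

theorem RR.prop {C : List V} {P : V → Prop} (hC : Cyc A C)
    (hP : ∀ c d S, RR A C c (d :: S) → P c → P d) {c : V} (hc : c ∈ C) (hPc : P c) :
    ∀ x ∈ C, P x := by
  obtain ⟨T, hT⟩ := RR.exists hC hc
  intro x hx
  rcases List.mem_cons.1 (hT.2.mem_iff.2 hx) with rfl | hx
  · exact hPc
  · exact RR.prop_aux hP T c [] (by simpa using hT) hPc x hx

theorem RR.lk {C : List V} {B : V → V → Prop}
    (hB : ∀ c d S, RR A C c (d :: S) → B c d) (S : List V) :
    ∀ c d T, RR A C c (S ++ d :: T) → Lk B c S d := by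
  induction S with
  | nil => intro c d T h; exact hB c d T h
  | cons s S ih =>
    intro c d T h
    refine ⟨hB c s _ h, ih s d (T ++ [c]) ?_⟩
    have := RR.next (S := S ++ d :: T) h
    simpa using this

theorem Lk.chg {B : V → V → Prop} {S : List V} {p v : V} (hBA : ∀ x y, B x y → A x y)
    (hp : ∀ x, B x p → A x v) : ∀ {q : V}, Lk B q S p → Lk A q S v := by
  induction S with
  | nil => intro q h; exact hp q h
  | cons s S ih => intro q h; exact ⟨hBA _ _ h.1, ih h.2⟩

theorem one_side [Fintype V] (hirr : ∀ v, ¬A v v) {m : ℕ} (hm : m + 2 = Fintype.card V)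
    (hmax : ∀ L, Cyc A L → L.Nodup → L.length ≤ m ∨ L.length = Fintype.card V)
    {C : List V} {w w' : V} (hC : Cyc A C) (hlen : C.length = m) (hF : Full (C ++ [w, w']))
    (hd : Fintype.card V ≤ deg A w) :
    (∀ c d S, RR A C c (d :: S) → (A c w ↔ ¬A w d)) ∧ A w w' ∧ A w' w ∧
      deg A w = Fintype.card V := by
  have hnd := hF.1
  have hw : w ∉ C := by
    intro h
    rw [List.nodup_append] at hnd
    exact hnd.2.2 w h w (by simp) rfl
  have hCnd : C.Nodup := hnd.sublist (by simp)
  have hde := deg_eq (A := A) hF w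
  simp only [cnt_append, cnt, ind_neg (hirr w)] at hde
  have key : ∀ c d S, RR A C c (d :: S) →
      cnt A w C + 1 ≤ m + ind (A w d) + ind (A c w) ∧ ¬(A c w ∧ A w d) := by
    intro c d S h
    have hl := h.2.length_eq
    have hpd : (w :: c :: d :: S).Nodup := by
      rw [List.nodup_cons, h.2.mem_iff, h.2.nodup_iff]; exact ⟨hw, hCnd⟩
    constructor
    · have hp : Pa A d c ([d] ++ S ++ [c]) := (Pa.one d).snoc h.1.2
      have hperm : ([d] ++ S ++ [c]).Perm (c :: d :: S) := by
        have := List.perm_append_comm (l₁ := d :: S) (l₂ := [c])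
        simpa using this
      have hni : ¬Ins A w ([d] ++ S ++ [c]) := by
        intro hi
        obtain ⟨Q', k1, k2⟩ := hp.ins hi
        have k3 := k2.trans (hperm.cons w)
        have := hmax Q' ⟨d, c, k1, h.1.1⟩ (k3.nodup_iff.2 hpd)
        have := k3.length_eq
        simp only [List.length_cons] at *
        omega
      have := cnt_ins hp hni
      rw [cnt_perm w (hperm.trans h.2), (hperm.trans h.2).length_eq] at this
      omega
    · rintro ⟨a1, a2⟩
      have hk : Lk A c (w :: d :: S) c := ⟨a1, a2, h.1.2⟩
      obtain ⟨e, k1, k2⟩ := hk.pa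
      have hper : (c :: w :: d :: S).Perm (w :: c :: d :: S) := List.Perm.swap _ _ _
      have := hmax _ ⟨c, e, k1, k2⟩ (hper.nodup_iff.2 hpd)
      simp only [List.length_cons] at *
      omega
  obtain ⟨f, e, hfe, _⟩ := id hC
  obtain ⟨d, S, hR⟩ := RR.exists_succ hirr hC hfe.mem_left
  have i1 := ind_le (A w w')
  have i2 := ind_le (A w' w)
  have two : ∀ p q : Prop, ¬(p ∧ q) → ind q + ind p ≤ 1 := by
    intro p q h; unfold ind; split <;> split <;> simp_all
  have h1 := key f d S hR
  have h2 := two _ _ h1.2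
  refine ⟨?_, ?_, ?_, by omega⟩
  · intro c d S h
    have h3 := key c d S h
    have h4 := two _ _ h3.2
    constructor
    · intro a b; exact h3.2 ⟨a, b⟩
    · intro a
      by_contra b
      rw [ind_neg a, ind_neg b] at h3
      omega
  · by_contra h
    rw [ind_neg h] at hde; omega
  · by_contra h
    rw [ind_neg h] at hde; omega

theorem raise [Fintype V] (hirr : ∀ v, ¬A v v) (hst : Star A) {m : ℕ}
    (hm : m + 2 = Fintype.card V)
    (hmax : ∀ L, Cyc A L → L.Nodup → L.length ≤ m ∨ L.length = Fintype.card V)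
    {C : List V} {u v c c' : V} (hC : Cyc A C) (hlen : C.length = m) (hF : Full (C ++ [u, v]))
    (huv : A u v) (g1 : c ∈ C) (g2 : A c u) (g3 : c' ∈ C) (g4 : A u c') :
    ∃ C' u', Cyc A C' ∧ C'.length = m ∧ Full (C' ++ [u', v]) ∧ Fintype.card V ≤ deg A u' := by
  by_cases hd : Fintype.card V ≤ deg A u
  · exact ⟨C, u, hC, hlen, hF, hd⟩
  obtain ⟨-, Q, z, f, e, h1, h2, h3, h4, h5, h6, h7⟩ := L3 hirr hst (by omega) hmax hC hlen hF
    (.cons huv (.one v)) (by simp) g1 g2 g3 g4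
  have hl := h2.length_eq
  refine ⟨Q ++ [u], z, Cyc.mk' h1 ⟨h5, h6⟩, by simp at *; omega, ?_, by omega⟩
  refine hF.perm ((h2.append_right [u, v]).symm.trans ?_)
  have : [z, u, v].Perm [u, z, v] := List.Perm.swap _ _ _
  simpa using this.append_left Q

theorem L4 [Fintype V] (hs : IsStrong A) (hirr : ∀ v, ¬A v v) (hst : Star A) {m : ℕ}
    (hm : m + 2 ≤ Fintype.card V)
    (hmax : ∀ L, Cyc A L → L.Nodup → L.length ≤ m ∨ L.length = Fintype.card V)
    (hout : ∀ v x, ∃ w, w ≠ x ∧ A v w) (hin : ∀ v x, ∃ w, w ≠ x ∧ A w v)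
    {L : List V} (hc : Cyc A L) (hnd : L.Nodup) (hlen : L.length = m) :
    ∃ C u v, m + 2 = Fintype.card V ∧ Cyc A C ∧ C.length = m ∧ Full (C ++ [u, v]) ∧
      Fintype.card V ≤ deg A u ∧ Fintype.card V ≤ deg A v := by
  obtain ⟨Q, U, f, e, h1, h2, h3, h4, h5⟩ := lemmaB hs hirr hst hm hmax hc hnd hlen
  have hn := h4.length
  simp only [List.length_append] at hn
  obtain ⟨u, b, U', rfl⟩ : ∃ u b U', U = u :: b :: U' := by
    match U with
    | [] => simp at hn; omega
    | [a] => simp at hn; omega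
    | a :: b :: U => exact ⟨_, _, _, rfl⟩
  have hQ : Cyc A Q := ⟨f, e, h1, h2⟩
  obtain ⟨w, hw⟩ := h3.toPa
  have hns : ∀ x ∈ (b :: U').tail, ¬A u x := by
    intro x hx hux
    obtain ⟨S, R, hS⟩ := List.append_of_mem hx
    simp only [List.tail_cons] at hS
    subst hS
    have h3' := h3.2.2
    rw [Lk.append] at h3'
    have hk : Lk A e (u :: x :: R) f := ⟨h3.1, hux, h3'.2⟩
    have := hmax _ (Cyc.mk' h1 hk) (h4.1.sublist (List.Sublist.append (List.Sublist.refl _)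
      (by
        refine List.Sublist.cons_cons _ ?_
        have : (x :: R).Sublist ((b :: S) ++ x :: R) := List.sublist_append_right _ _
        simp)))
    simp only [List.length_append, List.length_cons] at this hn
    omega
  obtain ⟨c', hc'b, hc'⟩ := hout u b
  have hc'Q : c' ∈ Q := by
    have := h4.2 c'
    rcases List.mem_append.1 this with h | h
    · exact h
    · exfalso
      rcases List.mem_cons.1 h with rfl | h
      · exact hirr _ hc'
      · rcases List.mem_cons.1 h with rfl | h
        · exact hc'b rfl
        · exact hns c' h hc'
  have hU1 := (L3 hirr hst hm hmax hQ h5 h4 hw hns h1.mem_right h3.1 hc'Q hc').1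
  have : U' = [] := by simpa using hU1
  subst this
  have hm2 : m + 2 = Fintype.card V := by simp at hn; omega
  obtain ⟨C, u', k1, k2, k3, k4⟩ := raise hirr hst hm2 hmax hQ h5 h4 h3.2.1 h1.mem_right h3.1 hc'Q hc'
  obtain ⟨-, -, hbu, -⟩ := one_side hirr hm2 hmax k1 k2 k3 k4
  have k3' : Full (C ++ [b, u']) := k3.perm ((List.Perm.swap _ _ _).append_left C)
  have hmem : ∀ x, x ≠ u' → x ≠ b → x ∈ C := by
    intro x hx1 hx2
    have := k3.2 x
    simpa [hx1, hx2] using this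
  obtain ⟨o, o1, o2⟩ := hout b u'
  obtain ⟨i, i1, i2⟩ := hin b u'
  obtain ⟨C', v', l1, l2, l3, l4⟩ := raise hirr hst hm2 hmax k1 k2 k3' hbu
    (hmem i i1 (by rintro rfl; exact hirr _ i2)) i2
    (hmem o o1 (by rintro rfl; exact hirr _ o2)) o2
  exact ⟨C', v', u', hm2, l1, l2, l3, l4, k4⟩

theorem noarc [Fintype V] {m : ℕ} (hm : m + 2 = Fintype.card V)
    (hmax : ∀ L, Cyc A L → L.Nodup → L.length ≤ m ∨ L.length = Fintype.card V)
    (hirr : ∀ v, ¬A v v)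
    {C : List V} {u v : V} (hC : Cyc A C) (hlen : C.length = m) (hF : Full (C ++ [u, v]))
    (huv : A u v)
    (hB : ∀ c d S, RR A C c (d :: S) → (A c u ↔ A d v) ∧ (A c v ↔ A d u))
    (h1 : ∀ x ∈ C, A x u ↔ ¬A x v)
    (h2 : ∀ x ∈ C, A u x ↔ A x u) (h3 : ∀ x ∈ C, A v x ↔ A x v)
    {z y : V} (hz : z ∈ C) (hy : y ∈ C) (hzv : A z v) (hyv : A y v) : ¬A z y := by
  intro hzy
  obtain ⟨T, hT⟩ := RR.exists hC hz
  have hyT : y ∈ T := by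
    rcases List.mem_cons.1 (hT.2.mem_iff.2 hy) with rfl | h
    · exact absurd hzy (hirr _)
    · exact h
  obtain ⟨T1, T2, rfl⟩ := List.append_of_mem hyT
  let B : V → V → Prop := fun x y => A x y ∧ (A x u ↔ A y v) ∧ (A x v ↔ A y u)
  have hB' : ∀ c d S, RR A C c (d :: S) → B c d := fun c d S h => ⟨h.1.1, hB c d S h⟩
  have hBA : ∀ x y, B x y → A x y := fun x y h => h.1
  have b1 := RR.lk hB' T1 z y T2 hT
  have b2 := RR.lk hB' T2 y z T1 hT.rot
  rcases List.eq_nil_or_concat T1 with rfl | ⟨Q, p, rfl⟩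
  · exact (h1 y hy).1 (b1.2.2.1 hzv) hyv
  rw [List.concat_eq_append] at *
  have b1' := Lk.append.1 b1
  have hpu : A p u := by have := b1'.2.2.1; exact this.2 hyv
  have a2 : Lk A y T2 u := Lk.chg hBA (fun x hx => hx.2.1.2 hzv) b2
  have a1 : Lk A u Q v := by
    match Q, b1'.1, hT with
    | [], _, _ => exact huv
    | q :: S, hq, hT =>
      have hqC : q ∈ C := hT.2.mem_iff.1 (by simp)
      exact ⟨(h2 q hqC).2 (hq.1.2.2.1 hzv), Lk.chg hBA (fun x hx => hx.2.2.2 hpu) hq.2⟩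
  have hk : Lk A u (Q ++ v :: z :: y :: T2) u :=
    Lk.append.2 ⟨a1, (h3 z hz).2 hzv, hzy, a2⟩
  obtain ⟨e, k1, k2⟩ := hk.pa
  have hl := hT.2.length_eq
  classical
  have hsub : (u :: (Q ++ v :: z :: y :: T2)).Subperm (C ++ [u, v]) := by
    rw [List.subperm_iff_count]
    intro a
    simp only [List.count_append, List.count_cons, List.count_nil, ← hT.2.count_eq]
    omega
  have hnd : (u :: (Q ++ v :: z :: y :: T2)).Nodup := by
    obtain ⟨l, p1, p2⟩ := hsub
    exact p1.nodup_iff.1 (hF.1.sublist p2)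
  have := hmax _ ⟨u, e, k1, k2⟩ hnd
  simp only [List.length_append, List.length_cons, List.length_nil] at this hl
  omega

end

section
variable {V : Type*} {A : V → V → Prop}

theorem structure1 [Fintype V] {m : ℕ} (hm : m + 2 = Fintype.card V)
    (hmax : ∀ L, Cyc A L → L.Nodup → L.length ≤ m ∨ L.length = Fintype.card V)
    (hirr : ∀ v, ¬A v v) 
    (hout : ∀ v x, ∃ w, w ≠ x ∧ A v w) (hin : ∀ v x, ∃ w, w ≠ x ∧ A w v)
    {C : List V} {u v : V} (hC : Cyc A C) (hlen : C.length = m) (hF : Full (C ++ [u, v]))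
    (hdu : Fintype.card V ≤ deg A u) (hdv : Fintype.card V ≤ deg A v) :
    deg A u = Fintype.card V ∧ deg A v = Fintype.card V ∧
    (∀ x, A x u ↔ ¬A x v) ∧ (∀ x, A u x ↔ A x u) ∧ (∀ x, A v x ↔ A x v) ∧
    (∀ x y, A x u → A y u → ¬A x y) ∧ (∀ x y, A x v → A y v → ¬A x y) := by
  have hF' : Full (C ++ [v, u]) := hF.perm ((List.Perm.swap _ _ _).append_left C)
  obtain ⟨a1, huv, hvu, e1⟩ := one_side hirr hm hmax hC hlen hF hdu
  obtain ⟨a2, -, -, e2⟩ := one_side hirr hm hmax hC hlen hF' hdv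
  have hmem : ∀ x, x ≠ u → x ≠ v → x ∈ C := by
    intro x hx1 hx2
    have := hF.2 x
    simpa [hx1, hx2] using this
  have hnd := hF.1
  -- G2
  have G2 : ∀ w w', Full (C ++ [w, w']) → A w w' →
      (∀ c d S, RR A C c (d :: S) → (A c w' ↔ ¬A w' d)) →
      ∀ c d S, RR A C c (d :: S) → A c w → A d w' := by
    intro w w' hFw hww hw' c d S hR hcw
    have hN := hR.next
    obtain ⟨d', S', hS⟩ : ∃ d' S', S ++ [c] = d' :: S' := by
      cases S with
      | nil => exact ⟨_, _, rfl⟩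
      | cons s S => exact ⟨_, _, rfl⟩
    rw [hS] at hN
    rw [hw' d d' S' hN]
    intro hd'
    have hp : Pa A d' c (S ++ [c]) := by
      cases S with
      | nil =>
        simp at hS
        obtain ⟨rfl, rfl⟩ := hS
        exact .one _
      | cons s S =>
        simp at hS
        obtain ⟨rfl, hS⟩ := hS
        have := (Pa.one s).snoc hR.1.2.2
        simpa using this
    have hk : Lk A c [w, w'] d' := ⟨hcw, hww, hd'⟩
    have hl := hR.2.length_eq
    have hcyc := Cyc.mk' hp hk
    classical
    have hsub : (S ++ [c] ++ [w, w']).Subperm (C ++ [w, w']) := by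
      rw [List.subperm_iff_count]
      intro a
      simp only [List.count_append, List.count_cons, List.count_nil, ← hR.2.count_eq]
      omega
    have hnd' : (S ++ [c] ++ [w, w']).Nodup := by
      obtain ⟨l, p1, p2⟩ := hsub
      exact p1.nodup_iff.1 (hFw.1.sublist p2)
    have := hmax _ hcyc hnd'
    simp only [List.length_append, List.length_cons, List.length_nil] at this hl
    omega
  have s1 := G2 u v hF huv a2
  have s2 := G2 v u hF' hvu a1
  -- not both
  have nb : ∀ x ∈ C, ¬(A x u ∧ A x v) := by
    intro x hx hxx
    have hall := RR.prop (P := fun x => A x u ∧ A x v) hC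
      (fun c d S hR h => ⟨s2 c d S hR h.2, s1 c d S hR h.1⟩) hx hxx
    obtain ⟨d, d1, d2⟩ := hout u v
    have hd := hmem d (by rintro rfl; exact hirr _ d2) d1
    obtain ⟨c, S, hR⟩ := RR.exists_pred hirr hC hd
    have hc : c ∈ C := hR.2.mem_iff.1 (by simp)
    exact (a1 c d S hR).1 (hall c hc).1 d2
  have ab : ∀ x ∈ C, A x u ∨ A x v := by
    obtain ⟨c, c1, c2⟩ := hin u v
    exact RR.prop (P := fun x => A x u ∨ A x v) hC
      (fun c d S hR h => h.elim (fun h => .inr (s1 c d S hR h)) (fun h => .inl (s2 c d S hR h)))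
      (hmem c (by rintro rfl; exact hirr _ c2) c1) (.inl c2)
  have f1 : ∀ x ∈ C, A x u ↔ ¬A x v := by
    intro x hx
    have := nb x hx; have := ab x hx; tauto
  have hB : ∀ c d S, RR A C c (d :: S) → (A c u ↔ A d v) ∧ (A c v ↔ A d u) := by
    intro c d S hR
    have hc := f1 c (hR.2.mem_iff.1 (by simp))
    have hd := f1 d (hR.2.mem_iff.1 (by simp))
    have := s1 c d S hR; have := s2 c d S hR
    tauto
  have f2 : ∀ x ∈ C, A u x ↔ A x u := by
    intro x hx
    obtain ⟨c, S, hR⟩ := RR.exists_pred hirr hC hx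
    have := hB c x S hR
    have := a1 c x S hR
    have := f1 x hx
    tauto
  have f3 : ∀ x ∈ C, A v x ↔ A x v := by
    intro x hx
    obtain ⟨c, S, hR⟩ := RR.exists_pred hirr hC hx
    have := hB c x S hR
    have := a2 c x S hR
    have := f1 x hx
    tauto
  have n1 := fun {z y} => noarc (z := z) (y := y) hm hmax hirr hC hlen hF huv hB f1 f2 f3
  have n2 := fun {z y} => noarc (z := z) (y := y) hm hmax hirr hC hlen hF' hvu
    (fun c d S h => (hB c d S h).symm) (fun x hx => by have := f1 x hx; tauto) f3 f2
  have F1 : ∀ x, A x u ↔ ¬A x v := by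
    intro x
    by_cases h1 : x = u
    · subst h1; have := hirr x; tauto
    by_cases h2 : x = v
    · subst h2; have := hirr x; tauto
    exact f1 x (hmem x h1 h2)
  have F2 : ∀ x, A u x ↔ A x u := by
    intro x
    by_cases h1 : x = u
    · subst h1; rfl
    by_cases h2 : x = v
    · subst h2; tauto
    exact f2 x (hmem x h1 h2)
  have F3 : ∀ x, A v x ↔ A x v := by
    intro x
    by_cases h1 : x = u
    · subst h1; tauto
    by_cases h2 : x = v
    · subst h2; rfl
    exact f3 x (hmem x h1 h2)
  refine ⟨e1, e2, F1, F2, F3, ?_, ?_⟩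
  · intro x y hx hy hxy
    by_cases h1 : x = v
    · subst h1; have := F3 y; have := F1 y; tauto
    by_cases h2 : y = v
    · subst h2; have := F1 x; tauto
    exact n2 (hmem x (by rintro rfl; exact hirr _ hx) h1)
      (hmem y (by rintro rfl; exact hirr _ hy) h2) hx hy hxy
  · intro x y hx hy hxy
    by_cases h1 : x = u
    · subst h1; have := F2 y; have := F1 y; tauto
    by_cases h2 : y = u
    · subst h2; have := F1 x; tauto
    exact n1 (hmem x h1 (by rintro rfl; exact hirr _ hx))
      (hmem y h2 (by rintro rfl; exact hirr _ hy)) hx hy hxy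

theorem final [Fintype V] (hn : 4 ≤ Fintype.card V) (hst : Star A) {u v : V}
    (e1 : deg A u = Fintype.card V) (e2 : deg A v = Fintype.card V)
    (F1 : ∀ x, A x u ↔ ¬A x v) (F2 : ∀ x, A u x ↔ A x u) (F3 : ∀ x, A v x ↔ A x v)
    (N1 : ∀ x y, A x u → A y u → ¬A x y) (N2 : ∀ x y, A x v → A y v → ¬A x y) :
    Even (Fintype.card V) ∧ (IsKhalf A ∨ IsKhalfMinusArc A) := by
  classical
  have o1 : outDeg A u = inDeg A u := by
    unfold outDeg inDeg
    have : (fun w => A u w) = fun w => A w u := by ext w; exact F2 w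
    simp only [this]
  have o2 : outDeg A v = inDeg A v := by
    unfold outDeg inDeg
    have : (fun w => A v w) = fun w => A w v := by ext w; exact F3 w
    simp only [this]
  have k1 : 2 * {x | A x u}.ncard = Fintype.card V := by
    have : inDeg A u = {x | A x u}.ncard := rfl
    unfold deg at e1; omega
  have k2 : 2 * {x | A x v}.ncard = Fintype.card V := by
    have : inDeg A v = {x | A x v}.ncard := rfl
    unfold deg at e2; omega
  have K : ∀ x, 2 * {w | A x u ↔ ¬A w u}.ncard = Fintype.card V := by
    intro x
    by_cases hx : A x u
    · have : {w | A x u ↔ ¬A w u} = {w | A w v} := by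
        ext w; have := F1 w; simp only [Set.mem_setOf_eq]; tauto
      rw [this]; exact k2
    · have : {w | A x u ↔ ¬A w u} = {w | A w u} := by
        ext w; simp only [Set.mem_setOf_eq]; tauto
      rw [this]; exact k1
  have cross : ∀ x y, A x y → (A x u ↔ ¬A y u) := by
    intro x y h
    have := N1 x y; have := N2 x y; have := F1 x; have := F1 y
    tauto
  have so : ∀ x, {w | A x w} ⊆ {w | A x u ↔ ¬A w u} := fun x w h => cross x w h
  have si : ∀ x, {w | A w x} ⊆ {w | A x u ↔ ¬A w u} := by
    intro x w h
    have := cross w x h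
    simp only [Set.mem_setOf_eq]; tauto
  have do1 : ∀ x, 2 * outDeg A x ≤ Fintype.card V := by
    intro x
    have := Set.ncard_le_ncard (so x) (Set.toFinite _)
    have h : outDeg A x = {w | A x w}.ncard := rfl
    have := K x; omega
  have di1 : ∀ x, 2 * inDeg A x ≤ Fintype.card V := by
    intro x
    have := Set.ncard_le_ncard (si x) (Set.toFinite _)
    have h : inDeg A x = {w | A w x}.ncard := rfl
    have := K x; omega
  have do2 : ∀ x y, (A x u ↔ ¬A y u) → ¬A x y → 2 * outDeg A x + 2 ≤ Fintype.card V := by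
    intro x y h1 h2
    have : {w | A x w} ⊂ {w | A x u ↔ ¬A w u} :=
      (Set.ssubset_iff_of_subset (so x)).2 ⟨y, h1, h2⟩
    have := Set.ncard_lt_ncard this (Set.toFinite _)
    have h : outDeg A x = {w | A x w}.ncard := rfl
    have := K x; omega
  have di2 : ∀ x y, (A x u ↔ ¬A y u) → ¬A x y → 2 * inDeg A y + 2 ≤ Fintype.card V := by
    intro x y h1 h2
    have : {w | A w y} ⊂ {w | A y u ↔ ¬A w u} :=
      (Set.ssubset_iff_of_subset (si y)).2 ⟨x, by simp only [Set.mem_setOf_eq]; tauto, h2⟩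
    have := Set.ncard_lt_ncard this (Set.toFinite _)
    have h : inDeg A y = {w | A w y}.ncard := rfl
    have := K y; omega
  have same : ∀ x y, x ≠ y → (A x u ↔ A y u) →
      2 * Fintype.card V ≤ deg A x + deg A y + 1 := by
    intro x y hne hs
    have c1 := cross x y
    have c2 := cross y x
    by_cases hx : A x u
    · exact (hst x y u hne (by tauto) (by tauto) ((F2 x).2 hx) ((F2 y).2 (hs.1 hx))).1
    · have hx' : A x v := by have := F1 x; tauto
      have hy' : A y v := by have := F1 y; tauto
      exact (hst x y v hne (by tauto) (by tauto) ((F3 x).2 hx') ((F3 y).2 hy')).1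
  have uniq : ∀ a b x y, (A a u ↔ ¬A b u) → ¬A a b → (A x u ↔ ¬A y u) → ¬A x y →
      x = a ∧ y = b := by
    intro a b x y h1 h2 h3 h4
    have p1 := do2 a b h1 h2
    have p2 := di2 a b h1 h2
    have p3 := do2 x y h3 h4
    have p4 := di2 x y h3 h4
    have q1 := do1 b
    have q2 := di1 a
    have q3 := do1 y
    have q4 := di1 x
    by_cases hax : A a u ↔ A x u
    · have e1 : x = a := by
        by_contra hne
        have := same x a hne (by tauto)
        simp only [deg] at this
        omega
      have e2 : y = b := by
        by_contra hne
        have := same y b hne (by tauto)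
        simp only [deg] at this
        omega
      exact ⟨e1, e2⟩
    · exfalso
      have e1 : y = a := by
        by_contra hne
        have := same y a hne (by tauto)
        simp only [deg] at this
        omega
      subst e1
      have hK := K b
      have : 1 < {w | A b u ↔ ¬A w u}.ncard := by omega
      obtain ⟨a', ha', hne⟩ := Set.exists_ne_of_one_lt_ncard this y
      simp only [Set.mem_setOf_eq] at ha'
      have := same a' y hne (by tauto)
      have r1 := do1 a'
      have r2 := di1 a'
      simp only [deg] at this
      omega
  refine ⟨⟨_, by rw [← k1]; ring⟩, ?_⟩
  by_cases hmiss : ∃ a b, (A a u ↔ ¬A b u) ∧ ¬A a b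
  · right
    obtain ⟨a, b, h1, h2⟩ := hmiss
    refine ⟨{x | A x u}, a, b, k1, h1, ?_⟩
    intro x y
    constructor
    · intro h
      refine ⟨cross x y h, ?_⟩
      rintro ⟨rfl, rfl⟩; exact h2 h
    · rintro ⟨h, h'⟩
      by_contra hA
      exact h' (uniq a b x y h1 h2 h hA)
  · left
    push Not at hmiss
    exact ⟨{x | A x u}, k1, fun x y => ⟨cross x y, hmiss x y⟩⟩

theorem hasCycle_of {L : List V} (hc : Cyc A L) (hnd : L.Nodup) : HasCycle A L.length := by
  obtain ⟨f, e, hp, hef⟩ := hc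
  have hpos : 0 < L.length := List.length_pos_of_mem hp.mem_left
  have key : ∀ {a b : V} {l : List V}, Pa A a b l → ∀ i (h : i + 1 < l.length), A l[i] l[i + 1] := by
    intro a b l hp
    induction hp with
    | one a => intro i h; simp at h
    | @cons a b c l hab hp ih =>
      intro i h
      cases i with
      | zero =>
        obtain ⟨t, rfl⟩ := hp.eq_cons
        simpa using hab
      | succ i =>
        have := ih i (by simpa using h)
        simpa using this
  have hk := key hp
  obtain ⟨t, ht⟩ := hp.eq_cons
  obtain ⟨s, hs⟩ := hp.eq_snoc
  have h0 : L[0] = f := by simp [ht]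
  have hl : L[L.length - 1] = e := by simp [hs]
  haveI : NeZero L.length := ⟨by omega⟩
  refine ⟨fun i => L[i.val]'(ZMod.val_lt i), ?_, ?_⟩
  · intro i j hij
    have := (List.Nodup.getElem_inj_iff hnd).1 hij
    exact ZMod.val_injective _ this
  · intro i
    have hi := ZMod.val_lt i
    by_cases h : i.val + 1 < L.length
    · have hv : (i + 1).val = i.val + 1 := by
        rw [ZMod.val_add, ZMod.val_one_eq_one_mod, Nat.add_mod_mod, Nat.mod_eq_of_lt h]
      simp only [hv]
      exact hk _ h
    · have h1 : i.val + 1 = L.length := by omega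
      have hv : (i + 1).val = 0 := by
        rw [ZMod.val_add, ZMod.val_one_eq_one_mod, Nat.add_mod_mod, h1, Nat.mod_self]
      have h2 : i.val = L.length - 1 := by omega
      simp only [hv, h2, h0, hl]
      exact hef

end
end DK

/-- Theorem 1. -/
theorem darbinyan_karapetyan_theorem1 {V : Type*} [Fintype V] (A : V → V → Prop)
    (hirr : ∀ v : V, ¬A v v)
    (hstrong : IsStrong A)
    (hsemi : MinSemiDegreeGE A 2)
    (hstar : CondStar A) :
    HasCycle A (Fintype.card V - 1) ∨
      (Even (Fintype.card V) ∧ (IsKhalf A ∨ IsKhalfMinusArc A)) := by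
  classical
  rcases isEmpty_or_nonempty V with hV | ⟨⟨v0⟩⟩
  · right
    refine ⟨by simp, .inl ⟨∅, by simp, fun x => hV.elim x⟩⟩
  have hout : ∀ v x, ∃ w, w ≠ x ∧ A v w := by
    intro v x
    have h : 1 < {w | A v w}.ncard := (hsemi v).1
    obtain ⟨w, h1, h2⟩ := Set.exists_ne_of_one_lt_ncard h x
    exact ⟨w, h2, h1⟩
  have hin : ∀ v x, ∃ w, w ≠ x ∧ A w v := by
    intro v x
    have h : 1 < {w | A w v}.ncard := (hsemi v).2
    obtain ⟨w, h1, h2⟩ := Set.exists_ne_of_one_lt_ncard h x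
    exact ⟨w, h2, h1⟩
  have hst : DK.Star A := by
    intro x y u h1 h2 h3 h4 h5
    obtain ⟨h6, h7⟩ := hstar x y h1 h2 h3 ⟨u, h4, h5⟩
    have h8 := le_min_iff.1 h7
    omega
  by_cases hcy : HasCycle A (Fintype.card V - 1)
  · exact .inl hcy
  right
  obtain ⟨L0, l1, l2, l3⟩ := DK.init_cycle hstrong hirr hout v0
  let P : ℕ → Prop := fun k => ∃ L, DK.Cyc A L ∧ L.Nodup ∧ L.length = k
  have hP0 : P L0.length := ⟨L0, l1, l2, rfl⟩
  let m := Nat.findGreatest P (Fintype.card V - 1)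
  have hPm : P m := Nat.findGreatest_spec (P := P) (by omega) hP0
  have hle : m ≤ Fintype.card V - 1 := Nat.findGreatest_le _
  have hmax : ∀ L, DK.Cyc A L → L.Nodup → L.length ≤ m ∨ L.length = Fintype.card V := by
    intro L h1 h2
    have := DK.nodup_len h2
    by_cases h : L.length = Fintype.card V
    · exact .inr h
    · left
      exact Nat.le_findGreatest (P := P) (by omega) ⟨L, h1, h2, rfl⟩
  clear_value m
  obtain ⟨L, h1, h2, h3⟩ := hPm
  have hm : m + 2 ≤ Fintype.card V := by
    have : m ≠ Fintype.card V - 1 := by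
      intro h
      apply hcy
      rw [← h, ← h3]
      exact DK.hasCycle_of h1 h2
    omega
  obtain ⟨C, u, v, k1, k2, k3, k4, k5, k6⟩ := DK.L4 hstrong hirr hst hm hmax hout hin h1 h2 h3
  obtain ⟨e1, e2, F1, F2, F3, N1, N2⟩ := DK.structure1 k1 hmax hirr hout hin k2 k3 k4 k5 k6
  refine DK.final ?_ hst e1 e2 F1 F2 F3 N1 N2
  obtain ⟨f, e, hp, hef⟩ := k2
  match C, hp, k3 with
  | [], hp, _ => exact hp.ne.elim
  | [a], hp, _ =>
    have h := hp.mem_left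
    have h' := hp.mem_right
    simp at h h'
    subst h h'
    exact absurd hef (hirr _)
  | a :: b :: C, _, k3 => simp at k3; omega
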